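/- arXiv:math/9904117 — 3 statements merged into one kernel-verified Lean document; each statement's English description precedes it below -/
import Mathlib

section
/- Let a torus G act linearly on ℝ^m, and let Ψ be an abstract moment map defined on a neighborhood of the origin with Ψ(0) = 0. Then there exists a G-invariant smooth one-form μ on a (possibly smaller) neighborhood of the origin such that μ(ξ_M) = Ψ^ξ on that neighborhood for all ξ ∈ 𝔤. -/
theorem ContDiff.intervalIntegral_param_nat {H : Type} [NormedAddCommGroup H] [NormedSpace ℝ H]
    [ProperSpace H] (a b : ℝ) (n : ℕ) :
    ∀ {E : Type} [NormedAddCommGroup E] [NormedSpace ℝ E] [CompleteSpace E]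
      {F : H → ℝ → E}, ContDiff ℝ (⊤ : ℕ∞) (Function.uncurry F) →
      ContDiff ℝ n (fun x => ∫ t in a..b, F x t) := by
  induction n with
  | zero =>
    intro E _ _ _ F hF
    rw [Nat.cast_zero, contDiff_zero]
    exact intervalIntegral.continuous_parametric_intervalIntegral_of_continuous' hF.continuous a b
  | succ n ih =>
    intro E _ _ _ F hF
    have hF' : ContDiff ℝ (⊤ : ℕ∞)
        (Function.uncurry fun x t => fderiv ℝ (fun y => F y t) x) := by
      refine ContDiff.fderiv (m := (⊤ : ℕ∞)) (n := (⊤ : ℕ∞))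
        (f := fun (p : H × ℝ) y => F y p.2) ?_ contDiff_fst (by simp)
      exact hF.comp (contDiff_snd.prodMk (contDiff_snd.comp contDiff_fst))
    rw [Nat.cast_add, Nat.cast_one, contDiff_succ_iff_hasFDerivAt]
    refine ⟨fun x => ∫ t in a..b, fderiv ℝ (fun y => F y t) x, ih hF', fun x => ?_⟩
    have hc : ∀ y, Continuous (F y) := fun y =>
      hF.continuous.comp (f := fun t => (y, t)) (by fun_prop)
    have hc' : ∀ y, Continuous fun t => fderiv ℝ (fun y => F y t) y :=
      fun y => hF'.continuous.comp (g := Function.uncurry fun x t => fderiv ℝ (fun y => F y t) x)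
        (f := fun t => (y, t)) (by fun_prop)
    obtain ⟨C, hC⟩ :=
      ((isCompact_closedBall x 1).prod (isCompact_uIcc (a := a) (b := b))).exists_bound_of_continuousOn
        hF'.continuous.continuousOn
    refine intervalIntegral.hasFDerivAt_integral_of_dominated_of_fderiv_le
      (F' := fun x t => fderiv ℝ (fun y => F y t) x) (bound := fun _ => C)
      (Metric.closedBall_mem_nhds x one_pos)
      (.of_forall fun y => (hc y).aestronglyMeasurable) ((hc x).intervalIntegrable _ _)
      (hc' x).aestronglyMeasurable ?_ (by simp) ?_
    · exact .of_forall fun t ht y hy => hC (y, t) ⟨hy, Set.uIoc_subset_uIcc ht⟩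
    · refine .of_forall fun t _ y _ => DifferentiableAt.hasFDerivAt ?_
      exact ((hF.comp (contDiff_id.prodMk contDiff_const) :
        ContDiff ℝ (⊤ : ℕ∞) fun y => F y t).differentiable (by simp)) y

theorem ContDiff.intervalIntegral_param {H E : Type} [NormedAddCommGroup H] [NormedSpace ℝ H]
    [ProperSpace H] [NormedAddCommGroup E] [NormedSpace ℝ E] [CompleteSpace E]
    {F : H → ℝ → E} (hF : ContDiff ℝ (⊤ : ℕ∞) (Function.uncurry F)) (a b : ℝ) :
    ContDiff ℝ (⊤ : ℕ∞) (fun x => ∫ t in a..b, F x t) :=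
  contDiff_infty.2 fun n => ContDiff.intervalIntegral_param_nat a b n hF

theorem exists_smooth_form_of_eq_zero_on_ker {V : Type} [NormedAddCommGroup V] [NormedSpace ℝ V]
    [FiniteDimensional ℝ V] {f : V → ℝ} (hf : ContDiff ℝ (⊤ : ℕ∞) f)
    (P : V →L[ℝ] V) (hP : ∀ x, P (P x) = P x) (hfP : ∀ x, P x = 0 → f x = 0) :
    ∃ h : V → V →L[ℝ] ℝ, ContDiff ℝ (⊤ : ℕ∞) h ∧ (∀ x, h x (P x) = f x) ∧
      ∀ g : V →L[ℝ] V, (∀ x, g (P x) = P (g x)) → (∀ x, f (g x) = f x) →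
        ∀ x v, h (g x) (g v) = h x v := by
  have : ProperSpace V := FiniteDimensional.proper ℝ V
  have hdf : ContDiff ℝ (⊤ : ℕ∞) (fderiv ℝ f) := hf.fderiv_right (by simp)
  have hd : Differentiable ℝ f := hf.differentiable (by simp)
  let G : V → ℝ → V →L[ℝ] ℝ := fun x t => fderiv ℝ f (x - P x + t • P x)
  have hG : ContDiff ℝ (⊤ : ℕ∞) (Function.uncurry G) := by
    refine hdf.comp ?_
    have h1 : ContDiff ℝ (⊤ : ℕ∞) fun p : V × ℝ => P p.1 := P.contDiff.comp contDiff_fst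
    exact (contDiff_fst.sub h1).add (contDiff_snd.smul h1)
  have hGc : ∀ x, Continuous (G x) := fun x =>
    hG.continuous.comp (f := fun t => (x, t)) (by fun_prop)
  have happ : ∀ x v, (∫ t in (0:ℝ)..1, G x t) v = ∫ t in (0:ℝ)..1, G x t v := fun x v =>
    ContinuousLinearMap.intervalIntegral_apply ((hGc x).intervalIntegrable _ _) v
  refine ⟨fun x => ∫ t in (0:ℝ)..1, G x t, hG.intervalIntegral_param 0 1, fun x => ?_, ?_⟩
  · rw [happ]
    have hder : ∀ t : ℝ, HasDerivAt (fun t : ℝ => f (x - P x + t • P x)) (G x t (P x)) t := by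
      intro t
      refine (hd _).hasFDerivAt.comp_hasDerivAt t ?_
      simpa using ((hasDerivAt_id t).smul_const (P x)).const_add (x - P x)
    rw [intervalIntegral.integral_eq_sub_of_hasDerivAt (fun t _ => hder t)
      (((hGc x).clm_apply continuous_const).intervalIntegrable _ _)]
    rw [hfP (x - P x + (0:ℝ) • P x) (by simp [hP])]
    simp
  · intro g hgP hfg x v
    simp only [happ]
    congr 1
    ext t
    have hg : ∀ y, fderiv ℝ f (g y) (g v) = fderiv ℝ f y v := by
      intro y
      have h1 : HasFDerivAt (fun y => f (g y)) ((fderiv ℝ f (g y)).comp g) y :=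
        (hd _).hasFDerivAt.comp y g.hasFDerivAt
      simp only [hfg] at h1
      rw [h1.fderiv]; rfl
    simp only [G]
    rw [← hg]
    simp [hgP]

theorem LinearMap.exists_section_on_range {K M N : Type*} [Field K] [AddCommGroup M] [Module K M]
    [AddCommGroup N] [Module K N] (L : M →ₗ[K] N) :
    ∃ g : N →ₗ[K] M, ∀ y ∈ LinearMap.range L, L (g y) = y := by
  obtain ⟨s, hs⟩ := L.rangeRestrict.exists_rightInverse_of_surjective L.range_rangeRestrict
  obtain ⟨g, hg⟩ := LinearMap.exists_extend s
  refine ⟨g, fun y hy => ?_⟩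
  have h3 : g y = s ⟨y, hy⟩ := LinearMap.congr_fun hg ⟨y, hy⟩
  rw [h3]
  exact congrArg Subtype.val (LinearMap.congr_fun hs ⟨y, hy⟩)

theorem exists_coordinates_of_iInf_ker_le {W κ : Type} [NormedAddCommGroup W] [NormedSpace ℝ W]
    [FiniteDimensional ℝ W] [Fintype κ] (α : κ → W →L[ℝ] ℝ) :
    ∃ l : κ → (W →L[ℝ] ℝ) →L[ℝ] ℝ, ∀ φ : W →L[ℝ] ℝ,
      (∀ ξ, (∀ j, α j ξ = 0) → φ ξ = 0) → ∀ ξ, φ ξ = ∑ j, l j φ * α j ξ := by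
  let L : (κ → ℝ) →ₗ[ℝ] (W →L[ℝ] ℝ) := Fintype.linearCombination ℝ α
  obtain ⟨g, hg⟩ := L.exists_section_on_range
  refine ⟨fun j => LinearMap.toContinuousLinearMap ((LinearMap.proj j).comp g), fun φ hφ ξ => ?_⟩
  have hmem : φ ∈ LinearMap.range L := by
    have h1 : (φ : W →ₗ[ℝ] ℝ) ∈ Submodule.span ℝ (Set.range fun j => (α j : W →ₗ[ℝ] ℝ)) := by
      refine mem_span_of_iInf_ker_le_ker fun ξ hξ => ?_
      simp only [Submodule.mem_iInf, LinearMap.mem_ker] at hξ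
      exact hφ ξ hξ
    obtain ⟨c, hc⟩ := (Submodule.mem_span_range_iff_exists_fun ℝ).1 h1
    refine ⟨c, ?_⟩
    ext ξ
    have := LinearMap.congr_fun hc ξ
    simpa [L, Fintype.linearCombination_apply, _root_.sum_apply] using this
  conv_lhs => rw [← hg φ hmem]
  simp [L, Fintype.linearCombination_apply, _root_.sum_apply]

theorem exists_smooth_form_of_weights {V W ι : Type} [NormedAddCommGroup V] [NormedSpace ℝ V]
    [FiniteDimensional ℝ V] [NormedAddCommGroup W] [NormedSpace ℝ W] [FiniteDimensional ℝ W]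
    [DecidableEq ι] (A : W →L[ℝ] V →L[ℝ] V) (P J : ι → V →L[ℝ] V) (α : ι → W →L[ℝ] ℝ)
    (hP : ∀ i x, P i (P i x) = P i x) (hPP : ∀ i j, i ≠ j → ∀ x, P i (P j x) = 0)
    (hJ : ∀ i ξ x, J i (A ξ x) = α i ξ • P i x) (G : Set (V →L[ℝ] V))
    (hGP : ∀ g ∈ G, ∀ i x, g (P i x) = P i (g x)) (hGJ : ∀ g ∈ G, ∀ i x, g (J i x) = J i (g x))
    (T : Finset ι) :
    ∀ (K : Finset ι) (F : V → W →L[ℝ] ℝ), ContDiff ℝ (⊤ : ℕ∞) F →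
      (∀ g ∈ G, ∀ x, F (g x) = F x) → (∀ i ∈ K, ∀ x, P i x = 0 → F x = 0) →
      (∀ x ξ, (∀ i ∈ K, α i ξ = 0) → (∀ i ∈ T, P i x ≠ 0 → α i ξ = 0) → F x ξ = 0) →
      ∃ μ : V → V →L[ℝ] ℝ, ContDiff ℝ (⊤ : ℕ∞) μ ∧
        (∀ g ∈ G, ∀ x v, μ (g x) (g v) = μ x v) ∧ ∀ ξ x, μ x (A ξ x) = F x ξ := by
  induction T using Finset.induction_on with
  | empty =>
    intro K F hF hFG hFK hFα
    obtain ⟨l, hl⟩ := exists_coordinates_of_iInf_ker_le fun i : K => α i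
    choose h hh hhP hhG using fun i : K => exists_smooth_form_of_eq_zero_on_ker
      ((l i).contDiff.comp hF) (P i) (hP i)
      (fun x hx => by simp [hFK i i.2 x hx])
    refine ⟨fun x => ∑ i, (h i x).comp (J i), ?_, ?_, ?_⟩
    · exact ContDiff.sum fun i _ => (hh i).clm_comp contDiff_const
    · intro g hg x v
      simp only [_root_.sum_apply, ContinuousLinearMap.comp_apply]
      refine Finset.sum_congr rfl fun i _ => ?_
      rw [← hGJ g hg]
      exact hhG i g (hGP g hg i) (fun x => by simp [hFG g hg]) x _
    · intro ξ x
      rw [hl (F x) (fun ξ hξ => hFα x ξ (fun i hi => hξ ⟨i, hi⟩) (by simp))]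
      simp only [_root_.sum_apply, ContinuousLinearMap.comp_apply]
      refine Finset.sum_congr rfl fun i _ => ?_
      rw [hJ, map_smul, hhP, smul_eq_mul, mul_comm]
      rfl
  | insert j T hj ih =>
    intro K F hF hFG hFK hFα
    have hsub : ContDiff ℝ (⊤ : ℕ∞) fun x => F (x - P j x) :=
      hF.comp (contDiff_id.sub (P j).contDiff)
    have hsubG : ∀ g ∈ G, ∀ x, F (g x - P j (g x)) = F (x - P j x) := fun g hg x => by
      rw [← hGP g hg, ← map_sub, hFG g hg]
    have hPj : ∀ x, P j (x - P j x) = 0 := fun x => by simp [hP]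
    have hPi : ∀ i x, P i x = 0 → P i (x - P j x) = 0 := fun i x hx => by
      rcases eq_or_ne i j with rfl | hij
      · exact hPj x
      · simp [hx, hPP i j hij]
    obtain ⟨μ, hμ, hμG, hμA⟩ := ih K (fun x => F (x - P j x)) hsub hsubG
      (fun i hi x hx => hFK i hi _ (hPi i x hx))
      (fun x ξ h1 h2 => hFα _ ξ h1 fun i hi hx => by
        rcases Finset.mem_insert.1 hi with rfl | hi
        · exact absurd (hPj x) hx
        · exact h2 i hi fun h => hx (hPi i x h))
    obtain ⟨ν, hν, hνG, hνA⟩ := ih (insert j K) (fun x => F x - F (x - P j x)) (hF.sub hsub)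
      (fun g hg x => by rw [hFG g hg, hsubG g hg])
      (fun i hi x hx => by
        rcases Finset.mem_insert.1 hi with rfl | hi
        · simp [hx]
        · simp [hFK i hi x hx, hFK i hi _ (hPi i x hx)])
      (fun x ξ h1 h2 => by
        have h3 : ∀ i ∈ K, α i ξ = 0 := fun i hi => h1 i (Finset.mem_insert_of_mem hi)
        have h4 := h1 j (Finset.mem_insert_self j K)
        rw [_root_.sub_apply, hFα x ξ h3, hFα _ ξ h3, sub_zero]
        · intro i hi hx
          rcases Finset.mem_insert.1 hi with rfl | hi
          · exact h4
          · exact h2 i hi fun h => hx (hPi i x h)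
        · intro i hi hx
          rcases Finset.mem_insert.1 hi with rfl | hi
          · exact h4
          · exact h2 i hi hx)
    refine ⟨fun x => μ x + ν x, hμ.add hν, fun g hg x v => ?_, fun ξ x => ?_⟩
    · simp [hμG g hg, hνG g hg]
    · simp [hμA, hνA]

open Module.End in
theorem exists_weight_decomposition {E : Type} [NormedAddCommGroup E] [InnerProductSpace ℝ E]
    [FiniteDimensional ℝ E] {n : ℕ} (A : Fin n → E →ₗ[ℝ] E)
    (hcomm : ∀ i j x, A i (A j x) = A j (A i x))
    (hskew : ∀ i x y, inner ℝ (A i x) y = - inner ℝ x (A i y)) :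
    ∃ (ι : Type) (_ : Fintype ι) (P J : ι → E →ₗ[ℝ] E) (α : ι → Fin n → ℝ),
      (∀ x, ∑ i, P i x = x) ∧ (∀ i x, P i (P i x) = P i x) ∧
      (∀ i j, i ≠ j → ∀ x, P i (P j x) = 0) ∧ (∀ i k x, J i (A k x) = α i k • P i x) ∧
      (∀ i (ξ : Fin n → ℝ), ∑ k, ξ k * α i k = 0 → ∀ x, ∑ k, ξ k • A k (P i x) = 0) ∧
      ∀ g : E →ₗ[ℝ] E, (∀ k x, g (A k x) = A k (g x)) →
        ∀ i x, g (P i x) = P i (g x) ∧ g (J i x) = J i (g x) := by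
  classical
  let T : Fin n × Fin n → E →ₗ[ℝ] E := fun p => A p.1 ∘ₗ A p.2
  have hT : ∀ p, (T p).IsSymmetric := fun p x y => by
    simp only [T, LinearMap.comp_apply, hskew, neg_neg]
    rw [hcomm]
  have hTc : Pairwise (Function.onFun Commute T) := fun p q _ => by
    refine LinearMap.ext fun x => ?_
    simp only [T, Module.End.mul_apply, LinearMap.comp_apply]
    rw [hcomm p.2 q.1, hcomm p.1 q.1, hcomm p.2 q.2, hcomm p.1 q.2]
  let S : (Fin n × Fin n → ℝ) → Submodule ℝ E := fun χ => ⨅ p, eigenspace (T p) (χ p)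
  have hS : ⨆ χ, S χ = ⊤ := LinearMap.IsSymmetric.iSup_iInf_eq_top_of_commute hT hTc
  have hSo : OrthogonalFamily ℝ (fun χ => S χ) fun χ => (S χ).subtypeₗᵢ :=
    LinearMap.IsSymmetric.orthogonalFamily_iInf_eigenspaces hT
  have hmem : ∀ χ x, x ∈ S χ ↔ ∀ i j, A i (A j x) = χ (i, j) • x := fun χ x => by
    simp [S, T, Submodule.mem_iInf]
  obtain ⟨s, hs⟩ : ∃ s : Finset (Fin n × Fin n → ℝ), ⨆ χ : s, S χ = ⊤ := by
    obtain ⟨s, hs⟩ := WellFoundedGT.finite_ne_bot_of_iSupIndep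
      (hSo.independent) |>.exists_finset_coe
    refine ⟨s, top_le_iff.1 (hS ▸ iSup_le fun χ => ?_)⟩
    by_cases h : S χ = ⊥
    · simp [h]
    · have : χ ∈ s := by
        have : χ ∈ (s : Set _) := hs ▸ h
        exact this
      exact le_iSup (fun χ : s => S χ) ⟨χ, this⟩
  let P : s → E →ₗ[ℝ] E := fun i => (S i).starProjection
  have hPmem : ∀ (i : s) x, P i x ∈ S i := fun i x => Submodule.starProjection_apply_mem _ _
  have hPself : ∀ (i : s) x, x ∈ S i → P i x = x := fun i x hx =>
    Submodule.starProjection_eq_self_iff.2 hx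
  have hPzero : ∀ i j : s, i ≠ j → ∀ x ∈ S j, P i x = 0 := fun i j hij x hx => by
    refine (Submodule.starProjection_apply_eq_zero_iff _).2 ?_
    rw [Submodule.mem_orthogonal]
    intro u hu
    exact hSo (fun h => hij (Subtype.ext h)) ⟨u, hu⟩ ⟨x, hx⟩
  have hPsum : ∀ x, ∑ i, P i x = x := fun x =>
    (hSo.comp Subtype.val_injective).sum_projection_of_mem_iSup x (by
      show x ∈ ⨆ χ : s, S χ
      rw [hs]; trivial)
  have hPg : ∀ g : E →ₗ[ℝ] E, (∀ k x, g (A k x) = A k (g x)) →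
      ∀ i x, g (P i x) = P i (g x) := by
    intro g hg i x
    have hgS : ∀ j x, x ∈ S j → g x ∈ S j := fun j x hx => by
      rw [hmem] at hx ⊢
      intro a b
      rw [← hg, ← hg, hx, map_smul]
    conv_rhs => rw [← hPsum x, map_sum, map_sum]
    rw [Finset.sum_eq_single i, hPself i _ (hgS _ _ (hPmem i x))]
    · exact fun j _ hj => hPzero i j hj.symm _ (hgS _ _ (hPmem j x))
    · simp
  have hPA : ∀ k i x, A k (P i x) = P i (A k x) := fun k => hPg (A k) fun j x => hcomm k j x
  have key : ∀ i : s, ∃ (J : E →ₗ[ℝ] E) (α : Fin n → ℝ), (∀ k x, J (A k x) = α k • P i x) ∧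
      (∀ (ξ : Fin n → ℝ), ∑ k, ξ k * α k = 0 → ∀ x, ∑ k, ξ k • A k (P i x) = 0) ∧
      ∀ g : E →ₗ[ℝ] E, (∀ k x, g (A k x) = A k (g x)) → ∀ x, g (J x) = J (g x) := by
    intro i
    by_cases h : ∃ k, i.1 (k, k) ≠ 0
    · obtain ⟨k, hk⟩ := h
      refine ⟨A k ∘ₗ P i, fun j => i.1 (k, j), fun j x => ?_, fun ξ hξ x => ?_, fun g hg x => ?_⟩
      · rw [LinearMap.comp_apply, ← hPA]
        exact (hmem _ _).1 (hPmem i x) k j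
      · set y := ∑ j, ξ j • A j (P i x) with hy
        have hyS : y ∈ S i := by
          refine Submodule.sum_mem _ fun j _ => Submodule.smul_mem _ _ ?_
          rw [hPA]
          exact hPmem _ _
        have h1 : A k y = 0 := by
          rw [hy, map_sum]
          simp only [map_smul, (hmem _ _).1 (hPmem i x) k, smul_smul]
          rw [← Finset.sum_smul, hξ, zero_smul]
        have h2 := (hmem _ _).1 hyS k k
        rw [h1, map_zero] at h2
        exact (smul_eq_zero.1 h2.symm).resolve_left hk
      · simp only [LinearMap.comp_apply]
        rw [hg, hPg g hg]
    · push Not at h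
      have h0 : ∀ k x, A k (P i x) = 0 := fun k x => by
        have h1 := hskew k (P i x) (A k (P i x))
        rw [(hmem _ _).1 (hPmem i x) k k, h k, zero_smul, inner_zero_right, neg_zero] at h1
        exact inner_self_eq_zero.1 h1
      exact ⟨0, 0, by simp, by simp [h0], by simp⟩
  choose J α hJ hα hg using key
  exact ⟨s, inferInstance, P, J, α, hPsum, fun i x => hPself i _ (hPmem i x),
    fun i j hij x => hPzero i j hij _ (hPmem j x), hJ, hα,
    fun g h i x => ⟨hPg g h i x, hg i g h x⟩⟩

theorem exists_weight_decomposition_of_core {V : Type} [AddCommGroup V] [Module ℝ V]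
    [FiniteDimensional ℝ V] {n : ℕ} (B : V →ₗ[ℝ] V →ₗ[ℝ] ℝ) (hBsymm : ∀ x y, B x y = B y x)
    (hBpos : ∀ x, x ≠ 0 → 0 < B x x) (A : Fin n → V →ₗ[ℝ] V)
    (hcomm : ∀ i j x, A i (A j x) = A j (A i x))
    (hskew : ∀ i x y, B (A i x) y = - B x (A i y)) :
    ∃ (ι : Type) (_ : Fintype ι) (P J : ι → V →ₗ[ℝ] V) (α : ι → Fin n → ℝ),
      (∀ x, ∑ i, P i x = x) ∧ (∀ i x, P i (P i x) = P i x) ∧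
      (∀ i j, i ≠ j → ∀ x, P i (P j x) = 0) ∧ (∀ i k x, J i (A k x) = α i k • P i x) ∧
      (∀ i (ξ : Fin n → ℝ), ∑ k, ξ k * α i k = 0 → ∀ x, ∑ k, ξ k • A k (P i x) = 0) ∧
      ∀ g : V →ₗ[ℝ] V, (∀ k x, g (A k x) = A k (g x)) →
        ∀ i x, g (P i x) = P i (g x) ∧ g (J i x) = J i (g x) := by
  have hnonneg : ∀ x, 0 ≤ B x x := fun x => by
    rcases eq_or_ne x 0 with rfl | hx
    · simp
    · exact (hBpos x hx).le
  let c : InnerProductSpace.Core ℝ V :=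
    { inner := fun x y => B x y
      conj_inner_symm := fun x y => by simp [hBsymm x y]
      re_inner_nonneg := fun x => by simpa using hnonneg x
      add_left := fun x y z => by simp
      smul_left := fun x y r => by simp
      definite := fun x hx => by
        by_contra h
        exact (hBpos x h).ne' hx }
  let : NormedAddCommGroup V := c.toNormedAddCommGroup
  let : InnerProductSpace ℝ V := InnerProductSpace.ofCore c.toCore
  exact exists_weight_decomposition A hcomm hskew

theorem exists_average_form {V : Type} [NormedAddCommGroup V] [NormedSpace ℝ V]
    [FiniteDimensional ℝ V] (ρ : ℝ → V →L[ℝ] V) (hρ : Continuous ρ)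
    (hρ0 : ρ 0 = ContinuousLinearMap.id ℝ V)
    (hρadd : ∀ s t x, ρ (s + t) x = ρ s (ρ t x)) (hρ1 : ∀ x, ρ 1 x = x)
    (B : V →ₗ[ℝ] V →ₗ[ℝ] ℝ) (hBsymm : ∀ x y, B x y = B y x)
    (hBpos : ∀ x, x ≠ 0 → 0 < B x x) :
    ∃ C : V →ₗ[ℝ] V →ₗ[ℝ] ℝ, (∀ x y, C x y = C y x) ∧ (∀ x, x ≠ 0 → 0 < C x x) ∧
      (∀ t x y, C (ρ t x) (ρ t y) = C x y) ∧
      ∀ g : V →L[ℝ] V, (∀ t x, g (ρ t x) = ρ t (g x)) → (∀ x y, B (g x) (g y) = B x y) →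
        ∀ x y, C (g x) (g y) = C x y := by
  have hBc : Continuous fun p : V × V => B p.1 p.2 := by
    have h1 : Continuous fun x : V => LinearMap.toContinuousLinearMap (B x) :=
      (LinearMap.toContinuousLinearMap.toLinearMap ∘ₗ B).continuous_of_finiteDimensional
    exact (h1.comp continuous_fst).clm_apply continuous_snd
  have hc : ∀ x y, Continuous fun t => B (ρ t x) (ρ t y) := fun x y =>
    hBc.comp ((hρ.clm_apply continuous_const).prodMk (hρ.clm_apply continuous_const))
  have hi : ∀ x y a b, IntervalIntegrable (fun t => B (ρ t x) (ρ t y)) MeasureTheory.volume a b :=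
    fun x y a b => (hc x y).intervalIntegrable a b
  let C : V →ₗ[ℝ] V →ₗ[ℝ] ℝ := LinearMap.mk₂ ℝ (fun x y => ∫ t in (0:ℝ)..1, B (ρ t x) (ρ t y))
    (fun x x' y => by
      simp only [map_add, LinearMap.add_apply]
      exact intervalIntegral.integral_add (hi _ _ _ _) (hi _ _ _ _))
    (fun r x y => by simp)
    (fun x y y' => by
      simp only [map_add]
      exact intervalIntegral.integral_add (hi _ _ _ _) (hi _ _ _ _))
    (fun r x y => by simp)
  have hC : ∀ x y, C x y = ∫ t in (0:ℝ)..1, B (ρ t x) (ρ t y) := fun x y => rfl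
  refine ⟨C, fun x y => ?_, fun x hx => ?_, fun s x y => ?_, fun g hg hgB x y => ?_⟩
  · simp only [hC, hBsymm]
  · rw [hC]
    refine intervalIntegral.intervalIntegral_pos_of_pos (hi x x 0 1) (fun t => hBpos _ ?_) one_pos
    intro h
    have := hρadd (-t) t x
    rw [h, map_zero, neg_add_cancel, hρ0] at this
    exact hx this
  · have hper : Function.Periodic (fun t => B (ρ t x) (ρ t y)) 1 := fun t => by
      simp only [hρadd t 1, hρ1]
    have h1 := hper.intervalIntegral_add_eq s 0
    rw [zero_add] at h1
    rw [hC, hC, ← h1]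
    have h2 := intervalIntegral.integral_comp_add_right (a := 0) (b := 1)
      (fun t => B (ρ t x) (ρ t y)) s
    rw [zero_add, add_comm 1 s] at h2
    rw [← h2]
    simp only [hρadd]
  · simp only [hC, ← hg, hgB]

theorem exists_invariant_form {V : Type} [NormedAddCommGroup V] [NormedSpace ℝ V]
    [FiniteDimensional ℝ V] {n : ℕ} (R : (Fin n → ℝ) → V →L[ℝ] V) (hRc : Continuous R)
    (hR0 : R 0 = ContinuousLinearMap.id ℝ V) (hRadd : ∀ a b x, R (a + b) x = R a (R b x))
    (hRper : ∀ k : Fin n → ℤ, R (fun i => (k i : ℝ)) = ContinuousLinearMap.id ℝ V) :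
    ∃ B : V →ₗ[ℝ] V →ₗ[ℝ] ℝ, (∀ x y, B x y = B y x) ∧ (∀ x, x ≠ 0 → 0 < B x x) ∧
      ∀ a x y, B (R a x) (R a y) = B x y := by
  have hRcomm : ∀ a b x, R a (R b x) = R b (R a x) := fun a b x => by
    rw [← hRadd, add_comm, hRadd]
  have key : ∀ s : Finset (Fin n), ∃ B : V →ₗ[ℝ] V →ₗ[ℝ] ℝ, (∀ x y, B x y = B y x) ∧
      (∀ x, x ≠ 0 → 0 < B x x) ∧
      ∀ i ∈ s, ∀ t : ℝ, ∀ x y, B (R (Pi.single i t) x) (R (Pi.single i t) y) = B x y := by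
    intro s
    induction s using Finset.induction_on with
    | empty =>
      let b := Module.finBasis ℝ V
      refine ⟨∑ i, (LinearMap.mul ℝ ℝ).compl₁₂ (b.coord i) (b.coord i), fun x y => ?_,
        fun x hx => ?_, by simp⟩
      · simp [mul_comm]
      · obtain ⟨i, hi⟩ : ∃ i, b.coord i x ≠ 0 := by
          by_contra! h
          exact hx (b.forall_coord_eq_zero_iff.1 h)
        simp only [LinearMap.sum_apply, LinearMap.compl₁₂_apply, LinearMap.mul_apply']
        exact Finset.sum_pos' (fun i _ => mul_self_nonneg _)
          ⟨i, Finset.mem_univ _, mul_self_pos.2 hi⟩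
    | insert i s _ ih =>
      obtain ⟨B, hBs, hBp, hBi⟩ := ih
      obtain ⟨C, hCs, hCp, hCi, hCg⟩ := exists_average_form (fun t => R (Pi.single i t))
        (hRc.comp (f := fun t : ℝ => (Pi.single i t : Fin n → ℝ))
          (continuous_single (A := fun _ : Fin n => ℝ) i)) (by simp [hR0])
        (fun s t x => by simp only [Pi.single_add, hRadd])
        (fun x => by
          have h := hRper (Pi.single i 1)
          have h1 : (fun j => ((Pi.single i 1 : Fin n → ℤ) j : ℝ)) = Pi.single i 1 := by
            ext j
            rcases eq_or_ne j i with rfl | hj <;> simp [*]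
          rw [← h1, h]
          rfl) B hBs hBp
      refine ⟨C, hCs, hCp, fun j hj t => ?_⟩
      rcases Finset.mem_insert.1 hj with rfl | hj
      · exact hCi t
      · exact hCg _ (fun _ _ => hRcomm _ _ _) (hBi j hj t)
  obtain ⟨B, hBs, hBp, hBi⟩ := key Finset.univ
  refine ⟨B, hBs, hBp, fun a => ?_⟩
  rw [← Finset.univ_sum_single a]
  refine Finset.sum_induction _ (fun a => ∀ x y, B (R a x) (R a y) = B x y) ?_ (by simp [hR0])
    fun i hi => hBi i hi _
  intro a b ha hb x y
  rw [hRadd, hRadd, ha, hb]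

theorem exists_smooth_form_of_commuting {V : Type} [NormedAddCommGroup V] [NormedSpace ℝ V]
    [FiniteDimensional ℝ V] {n : ℕ} (A : (Fin n → ℝ) →L[ℝ] V →L[ℝ] V)
    (hcomm : ∀ ξ η x, A ξ (A η x) = A η (A ξ x))
    (B : V →ₗ[ℝ] V →ₗ[ℝ] ℝ) (hBsymm : ∀ x y, B x y = B y x) (hBpos : ∀ x, x ≠ 0 → 0 < B x x)
    (hskew : ∀ ξ x y, B (A ξ x) y = - B x (A ξ y))
    (G : Set (V →L[ℝ] V)) (hG : ∀ g ∈ G, ∀ ξ x, g (A ξ x) = A ξ (g x))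
    (F : V → (Fin n → ℝ) →L[ℝ] ℝ) (hF : ContDiff ℝ (⊤ : ℕ∞) F)
    (hFG : ∀ g ∈ G, ∀ x, F (g x) = F x) (hFA : ∀ ξ x, A ξ x = 0 → F x ξ = 0) :
    ∃ μ : V → V →L[ℝ] ℝ, ContDiff ℝ (⊤ : ℕ∞) μ ∧
      (∀ g ∈ G, ∀ x v, μ (g x) (g v) = μ x v) ∧ ∀ ξ x, μ x (A ξ x) = F x ξ := by
  classical
  have hAsum : ∀ ξ x, A ξ x = ∑ k, ξ k • A (Pi.single k 1) x := fun ξ x => by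
    conv_lhs => rw [pi_eq_sum_univ' ξ]
    simp [_root_.sum_apply]
  obtain ⟨ι, _, P, J, α, hPsum, hP, hPP, hJ, hα, hg⟩ :=
    exists_weight_decomposition_of_core B hBsymm hBpos
      (fun k => (A (Pi.single k 1) : V →ₗ[ℝ] V)) (fun i j x => hcomm _ _ x)
      (fun i x y => hskew _ x y)
  let a : ι → (Fin n → ℝ) →L[ℝ] ℝ := fun i => ∑ k, α i k • ContinuousLinearMap.proj k
  have ha : ∀ i ξ, a i ξ = ∑ k, ξ k * α i k := fun i ξ => by
    simp [a, _root_.sum_apply, mul_comm]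
  have hgG : ∀ g ∈ G, ∀ i x, g (P i x) = P i (g x) ∧ g (J i x) = J i (g x) := fun g hgG =>
    hg (g : V →ₗ[ℝ] V) (fun k x => hG g hgG _ x)
  refine exists_smooth_form_of_weights A (fun i => LinearMap.toContinuousLinearMap (P i))
    (fun i => LinearMap.toContinuousLinearMap (J i)) a hP hPP (fun i ξ x => ?_) G
    (fun g h i x => (hgG g h i x).1) (fun g h i x => (hgG g h i x).2) Finset.univ ∅ F hF hFG
    (by simp) (fun x ξ _ h => hFA ξ x ?_)
  · rw [hAsum, map_sum, ha, Finset.sum_smul]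
    refine Finset.sum_congr rfl fun k _ => ?_
    rw [map_smul, mul_smul]
    exact congrArg (ξ k • ·) (hJ i k x)
  · conv_lhs => rw [← hPsum x, map_sum]
    refine Finset.sum_eq_zero fun i hi => ?_
    by_cases hx : P i x = 0
    · rw [hx, map_zero]
    · rw [hAsum]
      exact hα i ξ (ha i ξ ▸ h i hi hx) x

/-- The sublevel sets of a positive definite form form a neighbourhood basis of the origin. -/
theorem exists_sublevel_subset {V : Type} [NormedAddCommGroup V] [NormedSpace ℝ V]
    [FiniteDimensional ℝ V] (B : V →ₗ[ℝ] V →ₗ[ℝ] ℝ) (hBpos : ∀ x, x ≠ 0 → 0 < B x x)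
    (hBc : Continuous fun x => B x x) {U : Set V} (hU : U ∈ nhds 0) :
    ∃ ε > 0, ∀ x, B x x < ε → x ∈ U := by
  have : ProperSpace V := FiniteDimensional.proper ℝ V
  obtain ⟨r, hr, hrU⟩ := Metric.mem_nhds_iff.1 hU
  obtain ⟨δ, hδ, hδB⟩ : ∃ δ > 0, ∀ x ∈ Metric.sphere (0 : V) 1, δ ≤ B x x := by
    rcases (Metric.sphere (0 : V) 1).eq_empty_or_nonempty with h | h
    · exact ⟨1, one_pos, by simp [h]⟩
    · obtain ⟨x₀, hx₀, hmin⟩ := (isCompact_sphere (0 : V) 1).exists_isMinOn h hBc.continuousOn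
      refine ⟨B x₀ x₀, hBpos _ ?_, fun x hx => hmin hx⟩
      rintro rfl
      simp at hx₀
  refine ⟨δ * r ^ 2, by positivity, fun x hx => hrU ?_⟩
  rw [mem_ball_zero_iff]
  rcases eq_or_ne x 0 with rfl | hx0
  · simpa
  have hn : 0 < ‖x‖ := norm_pos_iff.2 hx0
  have h1 := hδB (‖x‖⁻¹ • x) (by simp [norm_smul, hn.ne'])
  simp only [map_smul, LinearMap.smul_apply, smul_eq_mul] at h1
  have h2 : δ * ‖x‖ ^ 2 ≤ B x x := by
    calc δ * ‖x‖ ^ 2 ≤ ‖x‖⁻¹ * (‖x‖⁻¹ * B x x) * ‖x‖ ^ 2 := by gcongr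
      _ = B x x := by field_simp
  have h3 : ‖x‖ ^ 2 < r ^ 2 := lt_of_mul_lt_mul_left (h2.trans_lt hx) hδ.le
  exact lt_of_pow_lt_pow_left₀ 2 hr.le h3

/-- Let a torus `G` act linearly on `ℝ^m` (the torus `G = ℝⁿ/ℤⁿ` is
encoded through its representation `R : ℝⁿ → GL(ℝ^m)`, a smooth periodic one-parameter
family of linear maps with `R 0 = id` and `R (a+b) = R a ∘ R b`), and let `Ψ` be an
abstract moment map defined on an invariant neighborhood `U` of the origin with `Ψ(0) = 0`.
Then there exists a `G`-invariant smooth one-form `μ` on a (possibly smaller, invariant)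
neighborhood `U'` of the origin such that `μ(ξ_M) = Ψ^ξ` on `U'` for all `ξ ∈ 𝔤`,
where `ξ_M(x) = d/dt|₀ R(tξ)x`. -/
theorem stmt_10 {n m : ℕ}
    (R : (Fin n → ℝ) → ((Fin m → ℝ) →L[ℝ] (Fin m → ℝ)))
    (hR0 : R 0 = ContinuousLinearMap.id ℝ (Fin m → ℝ))
    (hRadd : ∀ a b : Fin n → ℝ, R (a + b) = (R a).comp (R b))
    (hRper : ∀ k : Fin n → ℤ,
      R (fun i => (k i : ℝ)) = ContinuousLinearMap.id ℝ (Fin m → ℝ))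
    (hRsmooth : ContDiff ℝ (⊤ : ℕ∞) (fun p : (Fin n → ℝ) × (Fin m → ℝ) => R p.1 p.2))
    (U : Set (Fin m → ℝ)) (hU : IsOpen U) (hU0 : (0 : Fin m → ℝ) ∈ U)
    (hUinv : ∀ (a : Fin n → ℝ) (x : Fin m → ℝ), x ∈ U → R a x ∈ U)
    (Ψ : (Fin m → ℝ) → ((Fin n → ℝ) →L[ℝ] ℝ))
    (hΨsmooth : ContDiffOn ℝ (⊤ : ℕ∞) Ψ U)
    (hΨinv : ∀ (a : Fin n → ℝ), ∀ x ∈ U, Ψ (R a x) = Ψ x)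
    (hΨloc : ∀ ξ : Fin n → ℝ,
      IsLocallyConstant
        (fun x : {x : Fin m → ℝ // x ∈ U ∧ ∀ t : ℝ, R (t • ξ) x = x} => Ψ x.1 ξ))
    (hΨ0 : Ψ 0 = 0) :
    ∃ U' : Set (Fin m → ℝ), U' ⊆ U ∧ IsOpen U' ∧ (0 : Fin m → ℝ) ∈ U' ∧
      (∀ (a : Fin n → ℝ) (x : Fin m → ℝ), x ∈ U' → R a x ∈ U') ∧
      ∃ μ : (Fin m → ℝ) → ((Fin m → ℝ) →L[ℝ] ℝ),
        ContDiffOn ℝ (⊤ : ℕ∞) μ U' ∧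
        (∀ (a : Fin n → ℝ), ∀ x ∈ U', ∀ v : Fin m → ℝ, μ (R a x) (R a v) = μ x v) ∧
        (∀ (ξ : Fin n → ℝ), ∀ x ∈ U',
          μ x (deriv (fun t : ℝ => R (t • ξ) x) 0) = Ψ x ξ) := by
  have hRs : ContDiff ℝ (⊤ : ℕ∞) R :=
    contDiff_clm_apply_iff.2 fun y => hRsmooth.comp (contDiff_id.prodMk contDiff_const)
  have hRadd' : ∀ a b x, R (a + b) x = R a (R b x) := fun a b x => by rw [hRadd]; rfl
  have hRcomm : ∀ a b x, R a (R b x) = R b (R a x) := fun a b x => by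
    rw [← hRadd', add_comm, hRadd']
  obtain ⟨B, hBsymm, hBpos, hBinv⟩ := exists_invariant_form R hRs.continuous hR0 hRadd' hRper
  set A := fderiv ℝ R 0
  have hA0 : ∀ ξ x, HasDerivAt (fun t : ℝ => R (t • ξ) x) (A ξ x) 0 := fun ξ x => by
    have h1 : HasFDerivAt R A ((0 : ℝ) • ξ) := by
      rw [zero_smul]; exact (hRs.differentiable (by simp) 0).hasFDerivAt
    have h2 := h1.comp_hasDerivAt (0 : ℝ) ((hasDerivAt_id (0 : ℝ)).smul_const ξ)
    rw [one_smul] at h2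
    simpa using h2.clm_apply (hasDerivAt_const (0 : ℝ) x)
  have hRA : ∀ b ξ x, R b (A ξ x) = A ξ (R b x) := fun b ξ x => by
    have h1 := (R b).hasFDerivAt.comp_hasDerivAt (0 : ℝ) (hA0 ξ x)
    have h2 := hA0 ξ (R b x)
    simp only [fun t : ℝ => hRcomm (t • ξ) b x] at h2
    exact h1.unique h2
  have hAcomm : ∀ ξ η x, A ξ (A η x) = A η (A ξ x) := fun ξ η x => by
    have h1 := (A ξ).hasFDerivAt.comp_hasDerivAt (0 : ℝ) (hA0 η x)
    have h2 := hA0 η (A ξ x)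
    simp only [hRA] at h2
    exact h1.unique h2
  let b : (Fin m → ℝ) →L[ℝ] (Fin m → ℝ) →L[ℝ] ℝ :=
    LinearMap.toContinuousLinearMap (LinearMap.toContinuousLinearMap.toLinearMap ∘ₗ B)
  have hBs : ContDiff ℝ (⊤ : ℕ∞) fun x => B x x := b.contDiff.clm_apply contDiff_id
  have hskew : ∀ ξ x y, B (A ξ x) y = - B x (A ξ y) := fun ξ x y => by
    have h1 : HasDerivAt (fun t : ℝ => b (R (t • ξ) x)) (b (A ξ x)) 0 :=
      b.hasFDerivAt.comp_hasDerivAt (0 : ℝ) (hA0 ξ x)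
    have h2 := h1.clm_apply (hA0 ξ y)
    have h3 : (fun t : ℝ => b (R (t • ξ) x) (R (t • ξ) y)) = fun _ => B x y :=
      funext fun t => hBinv _ _ _
    rw [h3] at h2
    have h4 := h2.unique (hasDerivAt_const (0 : ℝ) (B x y))
    simp only [zero_smul, hR0, ContinuousLinearMap.id_apply] at h4
    exact eq_neg_of_add_eq_zero_left h4
  have hfix : ∀ ξ x, A ξ x = 0 → ∀ t : ℝ, R (t • ξ) x = x := fun ξ x hx t => by
    have hd : ∀ t : ℝ, HasDerivAt (fun t : ℝ => R (t • ξ) x) 0 t := fun t => by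
      have h0 : HasDerivAt (fun s : ℝ => R (s • ξ) x) (A ξ x) (t - t) := by
        rw [sub_self]; exact hA0 ξ x
      have h1 := (R (t • ξ)).hasFDerivAt.comp_hasDerivAt t (h0.comp_sub_const t t)
      rw [hx, map_zero] at h1
      refine h1.congr_of_eventuallyEq (.of_forall fun s => ?_)
      simp only [Function.comp_apply]
      rw [← hRadd', ← add_smul, add_sub_cancel]
    have h2 := is_const_of_deriv_eq_zero (fun t => (hd t).differentiableAt)
      (fun t => (hd t).deriv) t 0
    simpa [hR0] using h2
  have hBnonneg : ∀ x, 0 ≤ B x x := fun x => by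
    rcases eq_or_ne x 0 with rfl | hx
    · simp
    · exact (hBpos x hx).le
  obtain ⟨ε, hε, hεU⟩ := exists_sublevel_subset B hBpos hBs.continuous (hU.mem_nhds hU0)
  have hΨker : ∀ ξ x, B x x < ε → A ξ x = 0 → Ψ x ξ = 0 := fun ξ x hx hAx => by
    let γ : unitInterval → {x : Fin m → ℝ // x ∈ U ∧ ∀ t : ℝ, R (t • ξ) x = x} := fun s =>
      ⟨(s : ℝ) • x, hεU _ (by
        simp only [map_smul, LinearMap.smul_apply, smul_eq_mul, ← mul_assoc]
        exact (mul_le_of_le_one_left (hBnonneg x)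
          (mul_le_one₀ s.2.2 s.2.1 s.2.2)).trans_lt hx),
        hfix ξ _ (by rw [map_smul, hAx, smul_zero])⟩
    have hγ : Continuous γ := by
      refine Continuous.subtype_mk ?_ _
      fun_prop
    have h1 := ((hΨloc ξ).comp_continuous hγ).apply_eq_of_preconnectedSpace 1 0
    simpa [γ, hΨ0] using h1
  let χ : (Fin m → ℝ) → ℝ := fun x => Real.smoothTransition (2 - 3 * ε⁻¹ * B x x)
  have hχ : ContDiff ℝ (⊤ : ℕ∞) χ :=
    Real.smoothTransition.contDiff.comp (contDiff_const.sub (contDiff_const.mul hBs))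
  have hχ0 : ∀ x, 2 * ε ≤ 3 * B x x → χ x = 0 := fun x hx =>
    Real.smoothTransition.zero_of_nonpos (by
      have : 2 ≤ 3 * ε⁻¹ * B x x := by
        rw [mul_right_comm, ← div_eq_mul_inv, le_div_iff₀ hε]; exact hx
      linarith)
  have hχ1 : ∀ x, 3 * B x x < ε → χ x = 1 := fun x hx =>
    Real.smoothTransition.one_of_one_le (by
      have : 3 * ε⁻¹ * B x x ≤ 1 := by
        rw [mul_right_comm, ← div_eq_mul_inv, div_le_one hε]; exact hx.le
      linarith)
  have hF : ContDiff ℝ (⊤ : ℕ∞) fun x => χ x • Ψ x := by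
    refine contDiff_iff_contDiffAt.2 fun x => ?_
    by_cases hx : x ∈ U
    · exact hχ.contDiffAt.smul (hΨsmooth.contDiffAt (hU.mem_nhds hx))
    · have h1 : ε ≤ B x x := not_lt.1 fun h => hx (hεU x h)
      have h2 : ∀ᶠ y in nhds x, 2 * ε < 3 * B y y :=
        (continuous_const.mul hBs.continuous).continuousAt.eventually_const_lt
          (by simp only [Pi.mul_apply]; linarith)
      refine (contDiffAt_const (c := 0)).congr_of_eventuallyEq ?_
      filter_upwards [h2] with y hy
      rw [hχ0 y hy.le, zero_smul]
  obtain ⟨μ, hμ, hμR, hμA⟩ := exists_smooth_form_of_commuting A hAcomm B hBsymm hBpos hskew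
    (Set.range R) (by rintro _ ⟨a, rfl⟩ ξ x; exact hRA a ξ x) _ hF
    (by
      rintro _ ⟨a, rfl⟩ x
      have h1 : χ (R a x) = χ x := by simp only [χ, hBinv]
      rcases lt_or_ge (B x x) ε with h | h
      · simp only [h1, hΨinv a x (hεU x h)]
      · simp only [h1, hχ0 x (by linarith), zero_smul])
    (fun ξ x hx => by
      rcases lt_or_ge (B x x) ε with h | h
      · simp [hΨker ξ x h hx]
      · simp [hχ0 x (by linarith)])
  refine ⟨{x | 3 * B x x < ε}, fun x hx => hεU x ?_,
    isOpen_lt (continuous_const.mul hBs.continuous) continuous_const, by simpa using hε,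
    fun a x hx => ?_, μ, hμ.contDiffOn, fun a x _ v => hμR _ ⟨a, rfl⟩ x v, fun ξ x hx => ?_⟩
  · have h1 : 3 * B x x < ε := hx
    linarith [hBnonneg x]
  · simpa only [Set.mem_ofPred_eq, hBinv] using hx
  · rw [(hA0 ξ x).deriv, hμA, hχ1 x hx, one_smul]
end

section
/- Let 𝔤 be a finite-dimensional real vector space and α₁, …, α_d ∈ 𝔤*. For I ⊆ {1, …, d} set 𝔤_I = ⋂_{i ∈ I} ker α_i and (ℂ^×)^I = {z ∈ ℂ^d : z_i ≠ 0 ⇔ i ∈ I}. Let Ψ : ℂ^d → 𝔤* ⊗ ℂ be a polynomial map in the variables z₁, …, z_d, z̄₁, …, z̄_d which vanishes at the origin and is such that for every subset I ⊆ {1, …, d} and every ξ ∈ 𝔤_I, the function Ψ^ξ = ⟨Ψ, ξ⟩ vanishes on (ℂ^×)^I. Then there exist polynomials f₁, …, f_d, g₁, …, g_d in ℂ[z₁, …, z_d, z̄₁, …, z̄_d] such that Ψ = Σ_{j=1}^d (z_j f_j + z̄_j g_j) α_j. -/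
open scoped ComplexConjugate

/-- A function `ℂ^d → ℂ` is a polynomial in `z₁, …, z_d, z̄₁, …, z̄_d` iff it is a finite
sum of monomials `c · z^k z̄^l`. -/
def IsPolyInZZbar {d : ℕ} (f : (Fin d → ℂ) → ℂ) : Prop :=
  ∃ γ : ((Fin d → ℕ) × (Fin d → ℕ)) →₀ ℂ,
    ∀ z : Fin d → ℂ,
      f z = γ.sum fun kl c => c * ∏ i, (z i ^ kl.1 i * conj (z i) ^ kl.2 i)

theorem IsPolyInZZbar.zero {d : ℕ} : IsPolyInZZbar (fun _ : Fin d → ℂ => 0) :=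
  ⟨0, fun _ => by simp⟩

theorem IsPolyInZZbar.monomial {d : ℕ} (c : ℂ) (k l : Fin d → ℕ) :
    IsPolyInZZbar (fun z : Fin d → ℂ => c * ∏ i, (z i ^ k i * conj (z i) ^ l i)) :=
  ⟨Finsupp.single (k, l) c, fun z => by simp⟩

theorem IsPolyInZZbar.add {d : ℕ} {f g : (Fin d → ℂ) → ℂ} (hf : IsPolyInZZbar f)
    (hg : IsPolyInZZbar g) : IsPolyInZZbar (fun z => f z + g z) := by
  classical
  obtain ⟨γ, hγ⟩ := hf
  obtain ⟨δ, hδ⟩ := hg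
  refine ⟨γ + δ, fun z => ?_⟩
  simp only [hγ, hδ]
  rw [Finsupp.sum_add_index' (by simp) (by intros; ring)]

theorem IsPolyInZZbar.sum {d : ℕ} {ι : Type*} (s : Finset ι) {f : ι → (Fin d → ℂ) → ℂ}
    (hf : ∀ a ∈ s, IsPolyInZZbar (f a)) : IsPolyInZZbar (fun z => ∑ a ∈ s, f a z) := by
  classical
  induction s using Finset.induction_on with
  | empty => simpa using IsPolyInZZbar.zero
  | insert a s ha ih =>
    simp only [Finset.sum_insert ha]
    exact (hf a (by simp)).add (ih fun b hb => hf b (by simp [hb]))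

/-- The character `u ↦ u^k ū^l` of the torus `(ℂ^×)^d`. -/
noncomputable def torusCharacter {d : ℕ} (kl : (Fin d → ℕ) × (Fin d → ℕ)) :
    (Fin d → ℂˣ) →* ℂ where
  toFun u := ∏ i, ((u i : ℂ) ^ kl.1 i * conj (u i : ℂ) ^ kl.2 i)
  map_one' := by simp
  map_mul' u v := by
    rw [← Finset.prod_mul_distrib]
    refine Finset.prod_congr rfl fun i _ => ?_
    simp only [Pi.mul_apply, Units.val_mul, map_mul]
    ring

theorem pow_mul_conj_pow_injective {k l k' l' : ℕ}
    (h : ∀ u : ℂˣ, (u : ℂ) ^ k * conj (u : ℂ) ^ l = (u : ℂ) ^ k' * conj (u : ℂ) ^ l') :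
    k = k' ∧ l = l' := by
  have hadd : k + l = k' + l' := by
    have h2 := h (Units.mk0 2 two_ne_zero)
    simp only [Units.val_mk0, Complex.conj_ofNat, ← pow_add] at h2
    exact Nat.pow_right_injective le_rfl (by exact_mod_cast h2)
  have hexp := h (Units.mk0 (Complex.exp Complex.I) (Complex.exp_ne_zero _))
  simp only [Units.val_mk0, ← Complex.exp_conj, Complex.conj_I, ← Complex.exp_nat_mul,
    ← Complex.exp_add] at hexp
  obtain ⟨n, hn⟩ := Complex.exp_eq_exp_iff_exists_int.1 hexp
  have him := congrArg Complex.im hn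
  simp at him
  have hn0 : n = 0 := by
    by_contra hne
    refine irrational_pi ⟨((k : ℚ) - l - k' + l') / (2 * n), ?_⟩
    have : (n : ℝ) ≠ 0 := by exact_mod_cast hne
    push_cast
    field_simp
    linarith
  have hsub : (k : ℤ) - l = k' - l' := by
    have : (k : ℝ) - l = k' - l' := by rw [hn0] at him; simp at him; linarith
    exact_mod_cast this
  omega

theorem torusCharacter_injective {d : ℕ} :
    Function.Injective (torusCharacter : (Fin d → ℕ) × (Fin d → ℕ) → ((Fin d → ℂˣ) →* ℂ)) := by
  classical
  intro a b hab
  have key (i : Fin d) : a.1 i = b.1 i ∧ a.2 i = b.2 i := by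
    refine pow_mul_conj_pow_injective fun u => ?_
    have hu := DFunLike.congr_fun hab (Pi.mulSingle i u)
    simp only [torusCharacter, MonoidHom.coe_mk, OneHom.coe_mk] at hu
    rwa [Finset.prod_eq_single i, Finset.prod_eq_single i, Pi.mulSingle_eq_same] at hu <;>
      simp +contextual [Pi.mulSingle_eq_of_ne]
  exact Prod.ext (funext fun i => (key i).1) (funext fun i => (key i).2)

theorem coeff_eq_zero_of_sum_torusCharacter {d : ℕ} (s : Finset ((Fin d → ℕ) × (Fin d → ℕ)))
    (c : (Fin d → ℕ) × (Fin d → ℕ) → ℂ)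
    (h : ∀ u : Fin d → ℂˣ, ∑ kl ∈ s, c kl * torusCharacter kl u = 0) :
    ∀ kl ∈ s, c kl = 0 := by
  have hli := (linearIndependent_monoidHom (Fin d → ℂˣ) ℂ).comp _ torusCharacter_injective
  refine linearIndependent_iff'.1 hli s c (funext fun u => ?_)
  simpa using h u

/-- A complex-valued functional vanishing on the common kernel of the real functionals `α i`,
`i ∈ I`, is a complex combination of them. -/
theorem exists_complex_combination {E : Type*} [AddCommGroup E] [Module ℝ E]
    {ι : Type*} [Fintype ι] (α : ι → Module.Dual ℝ E) (I : Finset ι) (φ : E →ₗ[ℝ] ℂ)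
    (h : ∀ ξ, (∀ i ∈ I, α i ξ = 0) → φ ξ = 0) :
    ∃ c : ι → ℂ, (∀ i ∉ I, c i = 0) ∧ ∀ ξ, φ ξ = ∑ i, c i * (α i ξ : ℂ) := by
  classical
  have real (ψ : Module.Dual ℝ E) (hψ : ∀ ξ, (∀ i ∈ I, α i ξ = 0) → ψ ξ = 0) :
      ∃ a : I → ℝ, ∀ ξ, ψ ξ = ∑ i, a i * α i ξ := by
    have hmem : ψ ∈ Submodule.span ℝ (Set.range fun i : I => α i) := by
      refine mem_span_of_iInf_ker_le_ker fun ξ hξ => hψ ξ ?_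
      simpa [Submodule.mem_iInf] using hξ
    obtain ⟨a, ha⟩ := (Submodule.mem_span_range_iff_exists_fun ℝ).1 hmem
    exact ⟨a, fun ξ => by simp [← ha]⟩
  obtain ⟨a, ha⟩ := real (Complex.reLm ∘ₗ φ) fun ξ hξ => by simp [h ξ hξ]
  obtain ⟨b, hb⟩ := real (Complex.imLm ∘ₗ φ) fun ξ hξ => by simp [h ξ hξ]
  refine ⟨fun i => if hi : i ∈ I then a ⟨i, hi⟩ + b ⟨i, hi⟩ * Complex.I else 0,
    fun i hi => by simp [hi], fun ξ => ?_⟩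
  have hsum : ∑ i, (if hi : i ∈ I then (a ⟨i, hi⟩ + b ⟨i, hi⟩ * Complex.I : ℂ) else 0) *
      (α i ξ : ℂ) = ∑ i : I, (a i + b i * Complex.I) * (α i ξ : ℂ) := by
    rw [← Finset.sum_subset (Finset.subset_univ I) (by simp +contextual), ← Finset.sum_coe_sort]
    simp
  have ha' := ha ξ
  have hb' := hb ξ
  simp only [LinearMap.comp_apply, Complex.reLm_coe, Complex.imLm_coe] at ha' hb'
  rw [hsum, ← Complex.re_add_im (φ ξ), ha', hb']
  push_cast
  rw [Finset.sum_mul, ← Finset.sum_add_distrib]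
  exact Finset.sum_congr rfl fun i _ => by ring

theorem exists_monomial_factorization {d : ℕ} (k l : Fin d → ℕ) (j : Fin d) (c : ℂ)
    (hc : k j = 0 → l j = 0 → c = 0) :
    ∃ f g : (Fin d → ℂ) → ℂ, IsPolyInZZbar f ∧ IsPolyInZZbar g ∧
      ∀ z, c * ∏ i, (z i ^ k i * conj (z i) ^ l i) = z j * f z + conj (z j) * g z := by
  classical
  by_cases hk : k j = 0
  · by_cases hl : l j = 0
    · exact ⟨_, _, .zero, .zero, fun z => by simp [hc hk hl]⟩
    · refine ⟨_, _, .zero, .monomial c k (Function.update l j (l j - 1)), fun z => ?_⟩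
      obtain ⟨m, hm⟩ := Nat.exists_eq_succ_of_ne_zero hl
      have herase : ∏ i ∈ Finset.univ.erase j,
          (z i ^ k i * conj (z i) ^ Function.update l j (l j - 1) i) =
          ∏ i ∈ Finset.univ.erase j, (z i ^ k i * conj (z i) ^ l i) :=
        Finset.prod_congr rfl fun i hi => by
          rw [Function.update_of_ne (Finset.ne_of_mem_erase hi)]
      rw [← Finset.mul_prod_erase _ _ (Finset.mem_univ j),
        ← Finset.mul_prod_erase _ _ (Finset.mem_univ j), herase]
      simp only [Function.update_self, hm, Nat.succ_eq_add_one, Nat.add_sub_cancel]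
      ring
  · refine ⟨_, _, .monomial c (Function.update k j (k j - 1)) l, .zero, fun z => ?_⟩
    obtain ⟨m, hm⟩ := Nat.exists_eq_succ_of_ne_zero hk
    have herase : ∏ i ∈ Finset.univ.erase j,
        (z i ^ Function.update k j (k j - 1) i * conj (z i) ^ l i) =
        ∏ i ∈ Finset.univ.erase j, (z i ^ k i * conj (z i) ^ l i) :=
      Finset.prod_congr rfl fun i hi => by
        rw [Function.update_of_ne (Finset.ne_of_mem_erase hi)]
    rw [← Finset.mul_prod_erase _ _ (Finset.mem_univ j),
      ← Finset.mul_prod_erase _ _ (Finset.mem_univ j), herase]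
    simp only [Function.update_self, hm, Nat.succ_eq_add_one, Nat.add_sub_cancel]
    ring

theorem monomial_restrict {d : ℕ} (I : Finset (Fin d)) (kl : (Fin d → ℕ) × (Fin d → ℕ))
    (u : Fin d → ℂˣ) [DecidablePred (· ∈ I)]
    [Decidable (∀ i ∉ I, kl.1 i = 0 ∧ kl.2 i = 0)] :
    ∏ i, ((if i ∈ I then (u i : ℂ) else 0) ^ kl.1 i *
        conj (if i ∈ I then (u i : ℂ) else 0) ^ kl.2 i) =
      if ∀ i ∉ I, kl.1 i = 0 ∧ kl.2 i = 0 then torusCharacter kl u else 0 := by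
  split_ifs with h
  · refine Finset.prod_congr rfl fun i _ => ?_
    by_cases hi : i ∈ I
    · simp [hi]
    · simp [hi, h i hi]
  · push Not at h
    obtain ⟨i, hi, hne⟩ := h
    refine Finset.prod_eq_zero (Finset.mem_univ i) ?_
    by_cases hk : kl.1 i = 0
    · simp [hi, hne hk]
    · simp [hi, hk]

theorem coeff_apply_eq_zero {E : Type*} [AddCommGroup E] [Module ℝ E] {d : ℕ}
    (β : ((Fin d → ℕ) × (Fin d → ℕ)) →₀ (E →ₗ[ℝ] ℂ)) (I : Finset (Fin d)) (ξ : E)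
    (h : ∀ z : Fin d → ℂ, (∀ i, z i ≠ 0 ↔ i ∈ I) →
      (β.sum fun kl c => (∏ i, (z i ^ kl.1 i * conj (z i) ^ kl.2 i)) • c) ξ = 0)
    (kl : (Fin d → ℕ) × (Fin d → ℕ)) (hkl : ∀ i ∉ I, kl.1 i = 0 ∧ kl.2 i = 0) :
    β kl ξ = 0 := by
  classical
  by_cases hmem : kl ∈ β.support
  · refine coeff_eq_zero_of_sum_torusCharacter
      (β.support.filter fun kl => ∀ i ∉ I, kl.1 i = 0 ∧ kl.2 i = 0) (fun kl => β kl ξ)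
      (fun u => ?_) kl (Finset.mem_filter.2 ⟨hmem, hkl⟩)
    have hz := h (fun i => if i ∈ I then (u i : ℂ) else 0) (by simp)
    rw [Finset.sum_filter]
    simpa only [Finsupp.sum, monomial_restrict, LinearMap.sum_apply, LinearMap.smul_apply,
      smul_eq_mul, ite_mul, zero_mul, mul_comm, mul_ite, mul_zero] using hz
  · simp [Finsupp.notMem_support_iff.1 hmem]

/-- Let `𝔤` be a finite-dimensional real vector space and
`α₁, …, α_d ∈ 𝔤*`.  For `I ⊆ {1, …, d}` set `𝔤_I = ⋂_{i ∈ I} ker α_i` and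
`(ℂ^×)^I = {z ∈ ℂ^d : z_i ≠ 0 ⇔ i ∈ I}`.  Let `Ψ : ℂ^d → 𝔤* ⊗ ℂ` be a polynomial map in
`z, z̄` which vanishes at the origin and such that for every `I` and every `ξ ∈ 𝔤_I` the
function `Ψ^ξ` vanishes on `(ℂ^×)^I`.  Then there exist polynomials `f_j, g_j` in `z, z̄`
with `Ψ = Σ_j (z_j f_j + z̄_j g_j) α_j`. -/
theorem stmt_15 {𝕘 : Type*} [AddCommGroup 𝕘] [Module ℝ 𝕘] [FiniteDimensional ℝ 𝕘]
    {d : ℕ} (α : Fin d → Module.Dual ℝ 𝕘)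
    (Ψ : (Fin d → ℂ) → (𝕘 →ₗ[ℝ] ℂ))
    (hpoly : ∃ β : ((Fin d → ℕ) × (Fin d → ℕ)) →₀ (𝕘 →ₗ[ℝ] ℂ),
      ∀ z : Fin d → ℂ,
        Ψ z = β.sum fun kl c => (∏ i, (z i ^ kl.1 i * conj (z i) ^ kl.2 i)) • c)
    (h0 : Ψ 0 = 0)
    (hvanish : ∀ (I : Finset (Fin d)) (ξ : 𝕘), (∀ i ∈ I, α i ξ = 0) →
      ∀ z : Fin d → ℂ, (∀ i, z i ≠ 0 ↔ i ∈ I) → Ψ z ξ = 0) :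
    ∃ f g : Fin d → ((Fin d → ℂ) → ℂ),
      (∀ j, IsPolyInZZbar (f j)) ∧ (∀ j, IsPolyInZZbar (g j)) ∧
      ∀ (z : Fin d → ℂ) (ξ : 𝕘),
        Ψ z ξ = ∑ j, (z j * f j z + conj (z j) * g j z) * (α j ξ : ℂ) := by
  classical
  obtain ⟨β, hβ⟩ := hpoly
  have hspan (kl : (Fin d → ℕ) × (Fin d → ℕ)) :
      ∃ c : Fin d → ℂ, (∀ j, kl.1 j = 0 → kl.2 j = 0 → c j = 0) ∧
        ∀ ξ, β kl ξ = ∑ j, c j * (α j ξ : ℂ) := by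
    obtain ⟨c, hc, hsum⟩ := exists_complex_combination α
      (Finset.univ.filter fun i => ¬(kl.1 i = 0 ∧ kl.2 i = 0)) (β kl) fun ξ hξ =>
        coeff_apply_eq_zero β _ ξ (fun z hz => by rw [← hβ]; exact hvanish _ ξ hξ z hz) kl
          (by simp)
    exact ⟨c, fun j hk hl => hc j (by simp [hk, hl]), hsum⟩
  choose c hc hsum using hspan
  choose f g hf hg hfg using fun kl j =>
    exists_monomial_factorization kl.1 kl.2 j (c kl j) (hc kl j)
  refine ⟨fun j z => ∑ kl ∈ β.support, f kl j z, fun j z => ∑ kl ∈ β.support, g kl j z,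
    fun j => .sum _ fun kl _ => hf kl j, fun j => .sum _ fun kl _ => hg kl j, fun z ξ => ?_⟩
  simp only [hβ, Finsupp.sum, LinearMap.sum_apply, LinearMap.smul_apply, smul_eq_mul, hsum,
    Finset.mul_sum, ← Finset.sum_add_distrib, ← hfg, Finset.sum_mul]
  rw [Finset.sum_comm]
  exact Finset.sum_congr rfl fun j _ => Finset.sum_congr rfl fun kl _ => by ring
end

section
/- Let 𝔤 be a finite-dimensional real vector space and α₁, …, α_d ∈ 𝔤*. For I ⊆ {1, …, d} set 𝔤_I = ⋂_{i ∈ I} ker α_i and (ℂ^×)^I = {z ∈ ℂ^d : z_i ≠ 0 ⇔ i ∈ I}. Let U ⊆ ℂ^d be an open neighborhood of the origin and Ψ : U → 𝔤* a smooth map (ℂ^d being regarded as ℝ^{2d}) which vanishes at the origin and is such that for every I ⊆ {1, …, d} and every ξ ∈ 𝔤_I, the function Ψ^ξ = ⟨Ψ, ξ⟩ vanishes on (ℂ^×)^I ∩ U. Then there exist an open neighborhood U′ ⊆ U of the origin and smooth complex-valued functions f₁, …, f_d, g₁, …, g_d on U′ such that Ψ = Σ_{j=1}^d (z_j f_j +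 z̄_j g_j) α_j on U′ (an identity in 𝔤* ⊗ ℂ). -/
open scoped ComplexConjugate

open Function

section ParametricIntegral

variable {E G : Type*} [NormedAddCommGroup E] [NormedSpace ℝ E] [FiniteDimensional ℝ E]
  [NormedAddCommGroup G] [NormedSpace ℝ G]

/-- Differentiation under the integral sign over a compact interval, for a jointly `C¹` integrand. -/
theorem hasFDerivAt_intervalIntegral_of_contDiff {F : E × ℝ → G} (hF : ContDiff ℝ 1 F)
    (a b : ℝ) (x₀ : E) :
    HasFDerivAt (fun x => ∫ t in a..b, F (x, t))
      (∫ t in a..b, (fderiv ℝ F (x₀, t)).comp (ContinuousLinearMap.inl ℝ E ℝ)) x₀ := by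
  have hF' : Continuous fun p : E × ℝ =>
      (fderiv ℝ F p).comp (ContinuousLinearMap.inl ℝ E ℝ) :=
    (hF.continuous_fderiv one_ne_zero).clm_comp continuous_const
  obtain ⟨C, hC⟩ := ((isCompact_closedBall x₀ 1).prod
    (isCompact_uIcc (a := a) (b := b))).exists_bound_of_continuousOn hF'.continuousOn
  have hcont : ∀ x : E, Continuous fun t : ℝ => F (x, t) := fun x =>
    hF.continuous.comp (by fun_prop)
  refine intervalIntegral.hasFDerivAt_integral_of_dominated_of_fderiv_le
    (F := fun x t => F (x, t)) (bound := fun _ => C)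
    (F' := fun x t => (fderiv ℝ F (x, t)).comp (ContinuousLinearMap.inl ℝ E ℝ))
    (Metric.closedBall_mem_nhds x₀ one_pos)
    (Filter.Eventually.of_forall fun x => (hcont x).aestronglyMeasurable)
    ((hcont x₀).intervalIntegrable _ _)
    (hF'.comp (by fun_prop : Continuous fun t : ℝ => (x₀, t))).aestronglyMeasurable
    (Filter.Eventually.of_forall fun t ht x hx => hC (x, t) ⟨hx, Set.uIoc_subset_uIcc ht⟩)
    intervalIntegrable_const (Filter.Eventually.of_forall fun t _ x _ => ?_)
  exact ((hF.differentiable one_ne_zero) (x, t)).hasFDerivAt.comp x (hasFDerivAt_prodMk_left x t)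

theorem contDiff_intervalIntegral_nat [CompleteSpace G] (n : ℕ) {F : E × ℝ → G}
    (hF : ContDiff ℝ n F) (a b : ℝ) : ContDiff ℝ n fun x => ∫ t in a..b, F (x, t) := by
  induction n generalizing F with
  | zero =>
    rw [Nat.cast_zero, contDiff_zero] at hF ⊢
    exact intervalIntegral.continuous_parametric_intervalIntegral_of_continuous'
      (f := fun x t => F (x, t)) hF a b
  | succ n ih =>
    have hF1 : ContDiff ℝ 1 F := hF.of_le (by norm_cast; omega)
    have hD := hasFDerivAt_intervalIntegral_of_contDiff hF1 a b
    rw [Nat.cast_succ] at hF ⊢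
    refine contDiff_succ_iff_fderiv_apply.2
      ⟨fun x => (hD x).differentiableAt, by simp, fun y => ?_⟩
    have hF' : ContDiff ℝ n fun p => fderiv ℝ F p (y, 0) :=
      (hF.fderiv_right le_rfl).clm_apply contDiff_const
    convert ih hF' using 1
    ext x
    have hint : IntervalIntegrable
        (fun t => (fderiv ℝ F (x, t)).comp (ContinuousLinearMap.inl ℝ E ℝ))
        MeasureTheory.volume a b :=
      (((hF1.continuous_fderiv one_ne_zero).comp
        (by fun_prop : Continuous fun t : ℝ => (x, t))).clm_comp
          continuous_const).intervalIntegrable _ _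
    rw [(hD x).fderiv, ContinuousLinearMap.intervalIntegral_apply hint]
    simp

/-- The integral over a compact interval of a jointly smooth function is smooth. -/
theorem contDiff_intervalIntegral [CompleteSpace G] {F : E × ℝ → G}
    (hF : ContDiff ℝ (⊤ : ℕ∞) F) (a b : ℝ) :
    ContDiff ℝ (⊤ : ℕ∞) fun x => ∫ t in a..b, F (x, t) :=
  contDiff_infty.2 fun n => contDiff_intervalIntegral_nat n (contDiff_infty.1 hF n) a b

end ParametricIntegral

/-- Coefficients of vectors in the span of a finite family can be chosen linearly. -/
theorem exists_linearMap_sum_smul_eq {K V ι : Type*} [Field K] [AddCommGroup V] [Module K V]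
    (α : ι → V) (I : Finset ι) :
    ∃ L : V →ₗ[K] (ι → K), ∀ v ∈ Submodule.span K (α '' I), v = ∑ i ∈ I, L v i • α i := by
  classical
  let f : (ι → K) →ₗ[K] V := ∑ i ∈ I, (LinearMap.proj i : (ι → K) →ₗ[K] K).smulRight (α i)
  obtain ⟨s, hs⟩ := f.rangeRestrict.exists_rightInverse_of_surjective f.range_rangeRestrict
  obtain ⟨L, hL⟩ := s.exists_extend
  refine ⟨L, fun v hv => ?_⟩
  have hvf : v ∈ LinearMap.range f := by
    refine Submodule.span_le.2 ?_ hv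
    rintro _ ⟨i, hi, rfl⟩
    exact ⟨Pi.single i 1, by simpa [f, Pi.single_apply] using fun h => absurd (Finset.mem_coe.1 hi) h⟩
  have h1 : L v = s ⟨v, hvf⟩ := LinearMap.congr_fun hL ⟨v, hvf⟩
  have h2 : f (s ⟨v, hvf⟩) = v := congrArg Subtype.val (LinearMap.congr_fun hs ⟨v, hvf⟩)
  rw [h1]
  simpa [f] using h2.symm

section CoordinateSubspaces

variable {ι : Type*} [Fintype ι] [DecidableEq ι]

/-- Hadamard's lemma for a smooth function vanishing on a complex coordinate hyperplane. -/
theorem exists_contDiff_eq_mul_add_conj_mul {h : (ι → ℂ) → ℝ} (hh : ContDiff ℝ (⊤ : ℕ∞) h)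
    (j : ι) (hj : ∀ z, z j = 0 → h z = 0) :
    ∃ f g : (ι → ℂ) → ℂ, ContDiff ℝ (⊤ : ℕ∞) f ∧ ContDiff ℝ (⊤ : ℕ∞) g ∧
      ∀ z, (h z : ℂ) = z j * f z + conj (z j) * g z := by
  let γ : (ι → ℂ) × ℝ → (ι → ℂ) := fun p => update p.1 j (p.2 * p.1 j)
  have hγ : ContDiff ℝ (⊤ : ℕ∞) γ := by
    refine contDiff_pi.2 fun i => ?_
    by_cases hi : i = j
    · subst hi
      simp only [γ, update_self]
      exact (Complex.ofRealCLM.contDiff.comp contDiff_snd).mul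
        ((contDiff_apply ℝ ℂ i).comp contDiff_fst)
    · simp only [γ, update_of_ne hi]
      exact (contDiff_apply ℝ ℂ i).comp contDiff_fst
  let F : ℂ → (ι → ℂ) → ℝ := fun w z => ∫ t in (0 : ℝ)..1, fderiv ℝ h (γ (z, t)) (Pi.single j w)
  have hsmooth : ∀ w, ContDiff ℝ (⊤ : ℕ∞) fun p => fderiv ℝ h (γ p) (Pi.single j w) := fun w =>
    ((hh.fderiv_right (by simp)).comp hγ).clm_apply contDiff_const
  have hF : ∀ w, ContDiff ℝ (⊤ : ℕ∞) fun z => (F w z : ℂ) := fun w =>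
    Complex.ofRealCLM.contDiff.comp (contDiff_intervalIntegral (hsmooth w) 0 1)
  have hint : ∀ w z, IntervalIntegrable (fun t => fderiv ℝ h (γ (z, t)) (Pi.single j w))
      MeasureTheory.volume 0 1 := fun w z =>
    ((hsmooth w).continuous.comp
      (by fun_prop : Continuous fun t : ℝ => (z, t))).intervalIntegrable _ _
  have key : ∀ z, h z = (z j).re * F 1 z + (z j).im * F Complex.I z := by
    intro z
    have hline : ∀ t : ℝ, HasDerivAt (fun t => h (γ (z, t)))
        (fderiv ℝ h (γ (z, t)) (Pi.single j (z j))) t := by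
      intro t
      refine ((hh.differentiable (by simp)) _).hasFDerivAt.comp_hasDerivAt t ?_
      refine hasDerivAt_pi.2 fun i => ?_
      by_cases hi : i = j
      · subst hi
        simpa [γ] using (Complex.ofRealCLM.hasDerivAt (x := t)).mul_const (z i)
      · simpa [γ, hi] using hasDerivAt_const t (z i)
    have hsplit : (Pi.single j (z j) : ι → ℂ) =
        (z j).re • (Pi.single j 1 : ι → ℂ) + (z j).im • (Pi.single j Complex.I : ι → ℂ) := by
      rw [← Pi.single_smul, ← Pi.single_smul, ← Pi.single_add]
      congr 1
      simp
    have h1 := intervalIntegral.integral_eq_sub_of_hasDerivAt (fun t _ => hline t) (hint (z j) z)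
    have h0 : h (γ (z, 0)) = 0 := hj _ (by simp [γ])
    have h1' : γ (z, 1) = z := by simp [γ]
    rw [h0, h1', sub_zero] at h1
    rw [← h1, hsplit]
    simp only [map_add, map_smul, smul_eq_mul]
    rw [intervalIntegral.integral_add ((hint 1 z).const_mul _) ((hint Complex.I z).const_mul _),
      intervalIntegral.integral_const_mul, intervalIntegral.integral_const_mul]
  refine ⟨fun z => (F 1 z - Complex.I * F Complex.I z) / 2,
    fun z => (F 1 z + Complex.I * F Complex.I z) / 2,
    ((hF 1).sub (contDiff_const.mul (hF Complex.I))).div_const 2,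
    ((hF 1).add (contDiff_const.mul (hF Complex.I))).div_const 2, fun z => ?_⟩
  rw [key z]
  apply Complex.ext <;> simp <;> ring

variable {V : Type*} [NormedAddCommGroup V] [NormedSpace ℝ V]

/-- A smooth map which vanishes where a coordinate in `I` vanishes, and whose value at `z` lies in
the span of those `α i`, `i ∈ I ∪ T`, with `z i ≠ 0`, is a combination of the `α i` with smooth
coefficients vanishing on the corresponding coordinate hyperplanes. -/
theorem exists_contDiff_eq_sum_smul_of_mem_span_union [FiniteDimensional ℝ V] (α : ι → V)
    (T : Finset ι) : ∀ (I : Finset ι) (Φ : (ι → ℂ) → V), ContDiff ℝ (⊤ : ℕ∞) Φ →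
      (∀ i ∈ I, ∀ z, z i = 0 → Φ z = 0) →
      (∀ z, Φ z ∈ Submodule.span ℝ (α '' {i | z i ≠ 0 ∧ i ∈ I ∪ T})) →
      ∃ h : ι → (ι → ℂ) → ℝ, (∀ i, ContDiff ℝ (⊤ : ℕ∞) (h i)) ∧
        (∀ i z, z i = 0 → h i z = 0) ∧ ∀ z, Φ z = ∑ i, h i z • α i := by
  induction T using Finset.induction_on with
  | empty =>
    intro I Φ hΦ hI hspan
    obtain ⟨L, hL⟩ := exists_linearMap_sum_smul_eq (K := ℝ) α I
    refine ⟨fun i z => if i ∈ I then L (Φ z) i else 0, fun i => ?_, fun i z hz => ?_, fun z => ?_⟩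
    · dsimp only
      split_ifs
      · exact (LinearMap.toContinuousLinearMap
          ((LinearMap.proj i : (ι → ℝ) →ₗ[ℝ] ℝ) ∘ₗ L)).contDiff.comp hΦ
      · exact contDiff_const
    · simp only [ite_eq_right_iff]
      intro hi
      simp [hI i hi z hz]
    · have hz : Φ z ∈ Submodule.span ℝ (α '' I) :=
        Submodule.span_mono (Set.image_mono fun i hi => by simpa using hi.2) (hspan z)
      simpa [ite_smul, Finset.sum_ite_mem] using hL _ hz
  | insert a T _ ih =>
    intro I Φ hΦ hI hspan
    have hE : ContDiff ℝ (⊤ : ℕ∞) fun z : ι → ℂ => update z a 0 := by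
      refine contDiff_pi.2 fun i => ?_
      by_cases hi : i = a
      · subst hi
        simpa using contDiff_const
      · simpa [hi] using contDiff_apply ℝ ℂ i
    have hEspan : ∀ z, Φ (update z a 0) ∈
        Submodule.span ℝ (α '' {i | z i ≠ 0 ∧ i ∈ I ∪ T}) := fun z => by
      refine Submodule.span_mono (Set.image_mono fun i hi => ?_) (hspan _)
      by_cases hia : i = a
      · subst hia
        simp at hi
      · simpa [hia] using hi
    obtain ⟨h₁, hs₁, hv₁, he₁⟩ := ih I (fun z => Φ (update z a 0)) (hΦ.comp hE)
      (fun i hi z hz => hI i hi _ (by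
        by_cases hia : i = a
        · simp [hia]
        · simpa [hia] using hz)) hEspan
    obtain ⟨h₂, hs₂, hv₂, he₂⟩ := ih (insert a I) (fun z => Φ z - Φ (update z a 0))
      (hΦ.sub (hΦ.comp hE))
      (fun i hi z hz => by
        by_cases hia : i = a
        · subst hia
          rw [← hz, update_eq_self, sub_self]
        · have hi' : i ∈ I := by simpa [hia] using hi
          rw [hI i hi' z hz, hI i hi' _ (by simpa [hia] using hz), sub_self])
      (fun z => Submodule.sub_mem _
        (Submodule.span_mono (Set.image_mono fun i hi => by simpa using hi) (hspan z))
        (Submodule.span_mono (Set.image_mono fun i hi => by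
          simp only [Set.mem_ofPred_eq, Finset.mem_union, Finset.mem_insert] at hi ⊢
          tauto) (hEspan z)))
    refine ⟨fun i z => h₁ i z + h₂ i z, fun i => (hs₁ i).add (hs₂ i), fun i z hz => ?_,
      fun z => ?_⟩
    · simp [hv₁ i z hz, hv₂ i z hz]
    · simp only [add_smul, Finset.sum_add_distrib, ← he₁, ← he₂]
      abel

/-- A smooth map on `ℂ^ι` whose value at `z` lies in the span of the `α i` with `z i ≠ 0` is a
combination of the `α i` with smooth coefficients vanishing on the coordinate hyperplanes. -/
theorem exists_contDiff_eq_sum_smul_of_mem_span [FiniteDimensional ℝ V] (α : ι → V)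
    {Φ : (ι → ℂ) → V} (hΦ : ContDiff ℝ (⊤ : ℕ∞) Φ)
    (hspan : ∀ z, Φ z ∈ Submodule.span ℝ (α '' {i | z i ≠ 0})) :
    ∃ h : ι → (ι → ℂ) → ℝ, (∀ i, ContDiff ℝ (⊤ : ℕ∞) (h i)) ∧
      (∀ i z, z i = 0 → h i z = 0) ∧ ∀ z, Φ z = ∑ i, h i z • α i :=
  exists_contDiff_eq_sum_smul_of_mem_span_union α Finset.univ ∅ Φ hΦ (by simp)
    (by simpa using hspan)

end CoordinateSubspaces

/-- A map smooth on a neighbourhood of a point agrees near that point with a globally smooth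
multiple of it by a real function supported in the neighbourhood. -/
theorem exists_contDiff_smul_eventuallyEq {E V : Type*} [NormedAddCommGroup E] [NormedSpace ℝ E]
    [FiniteDimensional ℝ E] [NormedAddCommGroup V] [NormedSpace ℝ V] {U : Set E} (hU : IsOpen U)
    {c : E} (hc : c ∈ U) {Ψ : E → V} (hΨ : ContDiffOn ℝ (⊤ : ℕ∞) Ψ U) :
    ∃ φ : E → ℝ, (∀ z ∉ U, φ z = 0) ∧ (∀ᶠ z in nhds c, φ z = 1) ∧
      ContDiff ℝ (⊤ : ℕ∞) fun z => φ z • Ψ z := by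
  obtain ⟨r, hr, hrU⟩ := Metric.nhds_basis_closedBall.mem_iff.1 (hU.mem_nhds hc)
  let φ : ContDiffBump c := ⟨r / 2, r, half_pos hr, half_lt_self hr⟩
  have htU : tsupport φ ⊆ U := φ.tsupport_eq.trans_subset hrU
  refine ⟨φ, fun z hz => image_eq_zero_of_notMem_tsupport fun h => hz (htU h),
    φ.eventuallyEq_one, contDiff_iff_contDiffAt.2 fun z => ?_⟩
  by_cases hz : z ∈ tsupport fun z => φ z • Ψ z
  swap
  · exact contDiffAt_const.congr_of_eventuallyEq (notMem_tsupport_iff_eventuallyEq.1 hz)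
  have hzU : z ∈ U := htU (tsupport_smul_subset_left φ Ψ hz)
  exact φ.contDiffAt.smul (hΨ.contDiffAt (hU.mem_nhds hzU))

/-- A continuous functional vanishing on the common kernel of finitely many others lies in their
span. -/
theorem mem_span_image_of_forall_eq_zero {E ι : Type*} [NormedAddCommGroup E] [NormedSpace ℝ E]
    [FiniteDimensional ℝ E] (α : ι → (E →L[ℝ] ℝ)) (I : Set ι) (φ : E →L[ℝ] ℝ)
    (h : ∀ ξ, (∀ i ∈ I, α i ξ = 0) → φ ξ = 0) : φ ∈ Submodule.span ℝ (α '' I) := by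
  have hmem : (φ : E →ₗ[ℝ] ℝ) ∈
      Submodule.span ℝ (Set.range fun i : I => (α i : E →ₗ[ℝ] ℝ)) := by
    refine FiniteDimensional.mem_span_of_iInf_ker_le_ker fun ξ hξ => ?_
    simp only [Submodule.mem_iInf, LinearMap.mem_ker] at hξ ⊢
    exact h ξ fun i hi => hξ ⟨i, hi⟩
  have := Submodule.mem_map_of_mem
    (f := (LinearMap.toContinuousLinearMap : (E →ₗ[ℝ] ℝ) ≃ₗ[ℝ] (E →L[ℝ] ℝ)).toLinearMap) hmem
  rw [Submodule.map_span, ← Set.range_comp] at this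
  rw [Set.image_eq_range]
  exact this

/-- Let `𝔤` be a finite-dimensional real vector space and
`α₁, …, α_d ∈ 𝔤*`.  For `I ⊆ {1, …, d}` set `𝔤_I = ⋂_{i ∈ I} ker α_i` and
`(ℂ^×)^I = {z : z_i ≠ 0 ⇔ i ∈ I}`.  Let `U ⊆ ℂ^d` be an open neighborhood of the origin
and `Ψ : U → 𝔤*` a smooth map (`ℂ^d` being regarded as `ℝ^{2d}`) which vanishes at the
origin and such that for every `I` and every `ξ ∈ 𝔤_I`, the function `Ψ^ξ` vanishes on
`(ℂ^×)^I ∩ U`.  Then there exist an open neighborhood `U′ ⊆ U` of the origin and smooth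
complex-valued functions `f_j, g_j` on `U′` such that
`Ψ = Σ_j (z_j f_j + z̄_j g_j) α_j` on `U′` (an identity in `𝔤* ⊗ ℂ`). -/
theorem stmt_16 {𝕘 : Type*} [NormedAddCommGroup 𝕘] [NormedSpace ℝ 𝕘]
    [FiniteDimensional ℝ 𝕘]
    {d : ℕ} (α : Fin d → (𝕘 →L[ℝ] ℝ))
    (U : Set (Fin d → ℂ)) (hU : IsOpen U) (hU0 : (0 : Fin d → ℂ) ∈ U)
    (Ψ : (Fin d → ℂ) → (𝕘 →L[ℝ] ℝ))
    (hΨsmooth : ContDiffOn ℝ (⊤ : ℕ∞) Ψ U)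
    (h0 : Ψ 0 = 0)
    (hvanish : ∀ (I : Finset (Fin d)) (ξ : 𝕘), (∀ i ∈ I, α i ξ = 0) →
      ∀ z ∈ U, (∀ i, z i ≠ 0 ↔ i ∈ I) → Ψ z ξ = 0) :
    ∃ U' : Set (Fin d → ℂ), U' ⊆ U ∧ IsOpen U' ∧ (0 : Fin d → ℂ) ∈ U' ∧
      ∃ f g : Fin d → ((Fin d → ℂ) → ℂ),
        (∀ j, ContDiffOn ℝ (⊤ : ℕ∞) (f j) U') ∧ (∀ j, ContDiffOn ℝ (⊤ : ℕ∞) (g j) U') ∧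
        ∀ z ∈ U', ∀ ξ : 𝕘,
          (Ψ z ξ : ℂ) = ∑ j, (z j * f j z + conj (z j) * g j z) * (α j ξ : ℂ) := by
  obtain ⟨φ, hφU, hφ1, hφΨ⟩ := exists_contDiff_smul_eventuallyEq hU hU0 hΨsmooth
  have hspan : ∀ z, φ z • Ψ z ∈ Submodule.span ℝ (α '' {i | z i ≠ 0}) := by
    intro z
    by_cases hz : z ∈ U
    · refine Submodule.smul_mem _ _ (mem_span_image_of_forall_eq_zero α _ _ fun ξ hξ => ?_)
      exact hvanish {i | z i ≠ 0} ξ (by simpa using hξ) z hz (by simp)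
    · simp [hφU z hz]
  obtain ⟨h, hh, hh0, hsum⟩ := exists_contDiff_eq_sum_smul_of_mem_span α hφΨ hspan
  choose f g hf hg hfg using fun j => exists_contDiff_eq_mul_add_conj_mul (hh j) j (hh0 j)
  obtain ⟨W, hW, hWo, hW0⟩ := eventually_nhds_iff.1 hφ1
  refine ⟨U ∩ W, Set.inter_subset_left, hU.inter hWo, ⟨hU0, hW0⟩, f, g,
    fun j => (hf j).contDiffOn, fun j => (hg j).contDiffOn, fun z hz ξ => ?_⟩
  have hΨz := hsum z
  rw [hW z hz.2, one_smul] at hΨz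
  simp only [hΨz, ← hfg]
  simp
end
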